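/- Let e ≥ 1, q = 2^{2e+1}, F = GF(q), and let σ be the field automorphism of F given by σ(x) = x^{2^{e+1}}. Let O be the Suzuki–Tits ovoid: the set of 1-dimensional subspaces of F^4 spanned by (0, 0, 1, 0) or by (x, y, x·y + x²·σ(x) + σ(y), 1) for x, y ∈ F. Let VSz(q) be the Suzuki–Tits ovoid graph: the graph with vertex set F^4 in which two distinct vectors u, v are adjacent if and only if the 1-dimensional subspace spanned by u − v belongs to O. Let κ be any non-degenerate quadratic form on F^4 of minus type, i.e., such that κ does not vanish identically on any 2-dimensional subspace of F^4, and let VO_4^-(q) be the graph with vertex set F^4 in which two distinct vectors u, v are adjacent if and only if κ(u − v) = 0. Then the graphs VO_4^-(q) and VSz(q) are not isomorphic. -/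

import Mathlib

/-- Membership of the direction of a vector `d ∈ F⁴` in the Suzuki–Tits ovoid:
the line spanned by `d` is spanned by `(0,0,1,0)` or by
`(x, y, xy + x²σ(x) + σ(y), 1)` where `σ(x) = x^(2^(e+1))`. -/
def InSuzukiTitsOvoid {F : Type*} [Field F] (e : ℕ) (d : Fin 4 → F) : Prop :=
  ∃ c : F, c ≠ 0 ∧
    (c • d = ![0, 0, 1, 0] ∨
      ∃ x y : F, c • d = ![x, y, x * y + x ^ 2 * x ^ 2 ^ (e + 1) + y ^ 2 ^ (e + 1), 1])

section Helpers

variable {F : Type*} [Field F]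

lemma st_isodep (κ : QuadraticForm F (Fin 4 → F))
    (hminus : ∀ W : Submodule F (Fin 4 → F), Module.finrank F ↥W = 2 →
      ∃ w ∈ W, κ w ≠ 0) (a b : Fin 4 → F) (ha : κ a = 0) (hb : κ b = 0)
    (hab : QuadraticMap.polar (⇑κ) a b = 0) (ha0 : a ≠ 0) : ∃ c : F, b = c • a := by
  by_contra hcon
  push Not at hcon
  have hli : LinearIndependent F ![a, b] := by
    rw [LinearIndependent.pair_iff' ha0]
    intro c hc
    exact hcon c hc.symm
  have hfr := finrank_span_eq_card hli
  obtain ⟨w, hw, hw0⟩ := hminus (Submodule.span F (Set.range ![a, b])) (by simpa using hfr)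
  apply hw0
  have : Set.range ![a, b] = {a, b} := by simp [Set.pair_comm]
  rw [this, Submodule.mem_span_pair] at hw
  obtain ⟨s, t, rfl⟩ := hw
  rw [QuadraticMap.map_add (⇑κ), QuadraticMap.map_smul, QuadraticMap.map_smul, ha, hb,
    QuadraticMap.polar_smul_left, QuadraticMap.polar_smul_right, hab]
  simp

lemma st_exp (κ : QuadraticForm F (Fin 4 → F)) (v a b : Fin 4 → F) (s t : F)
    (ha : κ a = 0) (hb : κ b = 0) :
    κ (v + t • b - s • a) = κ v + t * QuadraticMap.polar (⇑κ) v b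
      - s * QuadraticMap.polar (⇑κ) v a - s * t * QuadraticMap.polar (⇑κ) a b := by
  have : v + t • b - s • a = v + (t • b + (-s) • a) := by module
  rw [this, QuadraticMap.map_add (⇑κ), QuadraticMap.map_add (⇑κ), QuadraticMap.map_smul,
    QuadraticMap.map_smul, ha, hb, QuadraticMap.polar_add_right,
    QuadraticMap.polar_smul_right, QuadraticMap.polar_smul_right,
    QuadraticMap.polar_smul_right, QuadraticMap.polar_smul_left,
    QuadraticMap.polar_comm (⇑κ) b a]
  simp only [smul_eq_mul]
  ring

/-- lines go to lines -/
lemma st_line [Fintype F] (κ : QuadraticForm F (Fin 4 → F))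
    (hminus : ∀ W : Submodule F (Fin 4 → F), Module.finrank F ↥W = 2 →
      ∃ w ∈ W, κ w ≠ 0)
    (O : (Fin 4 → F) → Prop) (hO0 : ∀ d, O d → d ≠ 0)
    (hOs : ∀ d (c : F), c ≠ 0 → O d → O (c • d))
    (ψ : (Fin 4 → F) ≃ (Fin 4 → F))
    (hψ : ∀ x y, O (x - y) ↔ (ψ x ≠ ψ y ∧ κ (ψ x - ψ y) = 0))
    (x d : Fin 4 → F) (hd : O d) :
    ∃ f : F → F, Function.Surjective f ∧ ∀ t, ψ (x + t • d) = ψ x + f t • (ψ (x + d) - ψ x) := by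
  have key : ∀ t : F, ∃ c : F, ψ (x + t • d) - ψ x = c • (ψ (x + d) - ψ x) := by
    intro t
    by_cases ht : t = 0
    · exact ⟨0, by simp [ht]⟩
    by_cases ht1 : t = 1
    · exact ⟨1, by simp [ht1]⟩
    have h1 := (hψ (x + d) x).1 (by simpa using hd)
    have h2 := (hψ (x + t • d) x).1 (by simpa using hOs d t ht hd)
    have h3 := (hψ (x + t • d) (x + d)).1 (by
      have : x + t • d - (x + d) = (t - 1) • d := by module
      rw [this]
      exact hOs d _ (sub_ne_zero.2 ht1) hd)
    refine st_isodep κ hminus _ _ h1.2 h2.2 ?_ (sub_ne_zero.2 h1.1)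
    have h4 := st_exp κ 0 (ψ (x + d) - ψ x) (ψ (x + t • d) - ψ x) 1 1 h1.2 h2.2
    have h5 : (0 : Fin 4 → F) + (1 : F) • (ψ (x + t • d) - ψ x) - (1 : F) • (ψ (x + d) - ψ x)
      = ψ (x + t • d) - ψ (x + d) := by module
    rw [h5, h3.2] at h4
    have h6 : QuadraticMap.polar (⇑κ) 0 (ψ (x + t • d) - ψ x) = 0 :=
      QuadraticMap.polar_zero_left κ _
    have h7 : QuadraticMap.polar (⇑κ) 0 (ψ (x + d) - ψ x) = 0 :=
      QuadraticMap.polar_zero_left κ _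
    rw [h6, h7, QuadraticMap.map_zero] at h4
    linear_combination h4
  choose f hf using key
  refine ⟨f, ?_, fun t => by rw [← hf t]; abel⟩
  apply Finite.surjective_of_injective
  intro s t hst
  have h1 := hf s
  rw [hst, ← hf t] at h1
  have h2 := ψ.injective (sub_left_injective h1)
  exact smul_left_injective F (hO0 d hd) (add_left_cancel h2)

lemma st_par [Fintype F] (κ : QuadraticForm F (Fin 4 → F))
    (hminus : ∀ W : Submodule F (Fin 4 → F), Module.finrank F ↥W = 2 →
      ∃ w ∈ W, κ w ≠ 0)
    (O : (Fin 4 → F) → Prop) (hO0 : ∀ d, O d → d ≠ 0)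
    (hOs : ∀ d (c : F), c ≠ 0 → O d → O (c • d))
    (ψ : (Fin 4 → F) ≃ (Fin 4 → F))
    (hψ : ∀ x y, O (x - y) ↔ (ψ x ≠ ψ y ∧ κ (ψ x - ψ y) = 0))
    (x y d : Fin 4 → F) (hd : O d) :
    ∃ c : F, ψ (y + d) - ψ y = c • (ψ (x + d) - ψ x) := by
  obtain ⟨f, hf, hfx⟩ := st_line κ hminus O hO0 hOs ψ hψ x d hd
  obtain ⟨g, hg, hgy⟩ := st_line κ hminus O hO0 hOs ψ hψ y d hd
  by_cases hyx : ∃ t : F, y = x + t • d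
  · obtain ⟨t, rfl⟩ := hyx
    refine ⟨f (t + 1) - f t, ?_⟩
    have : x + t • d + d = x + (t + 1) • d := by module
    rw [this, hfx, hfx]
    module
  by_contra hcon
  push Not at hcon hyx
  have ha := (hψ (x + d) x).1 (by simpa using hd)
  have hb := (hψ (y + d) y).1 (by simpa using hd)
  set a := ψ (x + d) - ψ x with hadef
  set b := ψ (y + d) - ψ y with hbdef
  set v := ψ y - ψ x with hvdef
  have ha0 : a ≠ 0 := sub_ne_zero.2 ha.1
  have hb0 : b ≠ 0 := sub_ne_zero.2 hb.1
  have hB : QuadraticMap.polar (⇑κ) a b ≠ 0 := by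
    intro h
    obtain ⟨c, hc⟩ := st_isodep κ hminus a b ha.2 hb.2 h ha0
    exact hcon c hc
  -- lines are disjoint
  have hdis : ∀ s t : F, v + t • b - s • a ≠ 0 := by
    intro s t h
    obtain ⟨s', rfl⟩ := hf s
    obtain ⟨t', rfl⟩ := hg t
    have h1 : ψ (y + t' • d) = ψ (x + s' • d) := by
      rw [hfx, hgy, ← sub_eq_zero, ← h]
      module
    have h2 := ψ.injective h1
    apply hyx (s' - t')
    have : y = y + t' • d - t' • d := by module
    rw [this, h2]
    module
  -- adjacency is invariant
  have hadj : ∀ s s' t : F, κ (v + t • b - s • a) = 0 → ∃ t' : F, κ (v + t' • b - s' • a) = 0 := by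
    intro s s' t h
    have hne := hdis s t
    obtain ⟨s, rfl⟩ := hf s
    obtain ⟨t, rfl⟩ := hg t
    obtain ⟨s', rfl⟩ := hf s'
    have e1 : ∀ s t, v + g t • b - f s • a = ψ (y + t • d) - ψ (x + s • d) := by
      intro s t
      rw [hfx, hgy]; module
    rw [e1] at h hne
    have h1 := (hψ _ _).2 ⟨sub_ne_zero.1 hne, h⟩
    refine ⟨g (t + s' - s), ?_⟩
    rw [e1]
    refine ((hψ _ _).1 ?_).2
    convert h1 using 1
    module
  set p := QuadraticMap.polar (⇑κ) a b
  set pb := QuadraticMap.polar (⇑κ) v b with hpb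
  set pa := QuadraticMap.polar (⇑κ) v a
  -- special s
  set s0 := pb / p with hs0
  have hs0' : s0 * p = pb := by rw [hs0]; field_simp
  have hbad : ∀ t : F, κ (v + t • b - s0 • a) = κ v - s0 * pa := by
    intro t
    rw [st_exp κ v a b s0 t ha.2 hb.2]
    linear_combination (-t) * hs0'
  have hbad0 : κ v - s0 * pa ≠ 0 := by
    intro h
    have h1 : κ (v - s0 • a) = 0 := by
      have := hbad 0
      rw [h] at this
      simpa using this
    have h2 : QuadraticMap.polar (⇑κ) b (v - s0 • a) = 0 := by
      rw [QuadraticMap.polar_comm, QuadraticMap.polar_sub_left, QuadraticMap.polar_smul_left]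
      change pb - s0 * p = 0
      rw [hs0', sub_self]
    obtain ⟨c, hc⟩ := st_isodep κ hminus b _ hb.2 h1 h2 hb0
    apply hdis s0 (-c)
    have : v + (-c) • b - s0 • a = (v - s0 • a) - c • b := by module
    rw [this, hc, sub_self]
  -- good s
  obtain ⟨t', ht'⟩ := hadj (s0 - 1) s0 (-(κ v - (s0 - 1) * pa) / p) (by
    rw [st_exp κ v a b _ _ ha.2 hb.2]
    change κ v + _ * pb - _ * pa - _ * _ * p = 0
    rw [← hs0']
    field_simp
    ring)
  rw [hbad] at ht'
  exact hbad0 ht'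

lemma st_add [Fintype F] (κ : QuadraticForm F (Fin 4 → F))
    (hminus : ∀ W : Submodule F (Fin 4 → F), Module.finrank F ↥W = 2 →
      ∃ w ∈ W, κ w ≠ 0)
    (O : (Fin 4 → F) → Prop) (hO0 : ∀ d, O d → d ≠ 0)
    (hOs : ∀ d (c : F), c ≠ 0 → O d → O (c • d))
    (hspan : ∀ d, O d → ∀ v, v ∈ Submodule.span F {d' | O d' ∧ ∀ c : F, d' ≠ c • d})
    (ψ : (Fin 4 → F) ≃ (Fin 4 → F))
    (hψ : ∀ x y, O (x - y) ↔ (ψ x ≠ ψ y ∧ κ (ψ x - ψ y) = 0))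
    (d0 : Fin 4 → F) (hd0 : O d0) :
    ∀ x y, ψ (x + y) - ψ 0 = (ψ x - ψ 0) + (ψ y - ψ 0) := by
  have step : ∀ d d', O d → O d' → (∀ c : F, d' ≠ c • d) → ∀ x,
      ψ (x + d' + d) - ψ (x + d') = ψ (x + d) - ψ x := by
    intro d d' hd hd' hdd x
    obtain ⟨μ, hμ⟩ := st_par κ hminus O hO0 hOs ψ hψ x (x + d') d hd
    obtain ⟨ν, hν⟩ := st_par κ hminus O hO0 hOs ψ hψ x (x + d) d' hd'
    rw [hμ]
    have e : x + d + d' = x + d' + d := by abel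
    rw [e] at hν
    have h1 : (1 - ν) • (ψ (x + d') - ψ x) = (1 - μ) • (ψ (x + d) - ψ x) := by
      have : (ψ (x + d') - ψ x) + μ • (ψ (x + d) - ψ x) =
         (ψ (x + d) - ψ x) + ν • (ψ (x + d') - ψ x) := by
        rw [← hμ, ← hν]; abel
      rw [← sub_eq_zero] at this ⊢
      rw [← this]
      module
    by_cases hνe : 1 - ν = 0
    · rw [hνe, zero_smul] at h1
      have ha := (hψ (x + d) x).1 (by simpa using hd)
      rcases smul_eq_zero.1 h1.symm with h | h
      · rw [← sub_eq_zero.1 h, one_smul]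
      · exact absurd (sub_eq_zero.1 h) ha.1
    · exfalso
      obtain ⟨f, hf, hfx⟩ := st_line κ hminus O hO0 hOs ψ hψ x d hd
      obtain ⟨t, ht⟩ := hf ((1 - ν)⁻¹ * (1 - μ))
      have h2 : ψ (x + d') = ψ (x + t • d) := by
        rw [hfx, ht, mul_smul, ← h1, smul_smul, inv_mul_cancel₀ hνe, one_smul]
        abel
      exact hdd t (add_left_cancel (ψ.injective h2))
  have step2 : ∀ d, O d → ∀ v x, ψ (x + v + d) - ψ (x + v) = ψ (x + d) - ψ x := by
    intro d hd v
    have : ∀ c : F, ∀ x, ψ (x + c • v + d) - ψ (x + c • v) = ψ (x + d) - ψ x := by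
      induction hspan d hd v using Submodule.span_induction with
      | mem d' h =>
        intro c x
        by_cases hc : c = 0
        · simp [hc]
        refine step d (c • d') hd (hOs d' c hc h.1) ?_ x
        intro k hk
        apply h.2 (c⁻¹ * k)
        rw [mul_smul, ← hk, smul_smul, inv_mul_cancel₀ hc, one_smul]
      | zero => intro c x; simp
      | add u w _ _ hu hw =>
        intro c x
        rw [smul_add, ← add_assoc, hw, hu]
      | smul k u _ hu =>
        intro c x
        rw [smul_smul, hu]
    simpa using this 1
  intro x y
  have : ∀ c : F, ∀ x, ψ (x + c • y) - ψ x = ψ (c • y) - ψ 0 := by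
    induction hspan d0 hd0 y using Submodule.span_induction with
    | mem d' h =>
      intro c x
      by_cases hc : c = 0
      · simp [hc]
      have := step2 (c • d') (hOs d' c hc h.1) x 0
      simpa using this
    | zero => intro c x; simp
    | add u w _ _ hu hw =>
      intro c x
      have h1 := hw c (x + c • u)
      have h2 := hu c x
      have h3 := hw c (c • u)
      rw [smul_add, ← add_assoc]
      linear_combination (exp := 1) h1 + h2 - h3
    | smul k u _ hu =>
      intro c x
      rw [smul_smul, hu]
  have := this 1 x
  rw [one_smul] at this
  linear_combination (exp := 1) this

/-- the ovoid vector -/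
def stv (e : ℕ) (x y : F) : Fin 4 → F :=
  ![x, y, x * y + x ^ 2 * x ^ 2 ^ (e + 1) + y ^ 2 ^ (e + 1), 1]

lemma st_O3 (e : ℕ) : InSuzukiTitsOvoid e (![0, 0, 1, 0] : Fin 4 → F) :=
  ⟨1, one_ne_zero, Or.inl (one_smul _ _)⟩

lemma st_Ov (e : ℕ) (x y : F) : InSuzukiTitsOvoid e (stv e x y) :=
  ⟨1, one_ne_zero, Or.inr ⟨x, y, one_smul _ _⟩⟩

lemma st_O0 (e : ℕ) (d : Fin 4 → F) (h : InSuzukiTitsOvoid e d) : d ≠ 0 := by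
  rintro rfl
  obtain ⟨c, hc, h | ⟨x, y, h⟩⟩ := h
  · have := congrFun h 2
    simp at this
  · have := congrFun h 3
    simp at this

lemma st_Os (e : ℕ) (d : Fin 4 → F) (c : F) (hc : c ≠ 0) (h : InSuzukiTitsOvoid e d) :
    InSuzukiTitsOvoid e (c • d) := by
  obtain ⟨k, hk, h⟩ := h
  refine ⟨k * c⁻¹, mul_ne_zero hk (inv_ne_zero hc), ?_⟩
  rw [smul_smul, mul_assoc, inv_mul_cancel₀ hc, mul_one]
  exact h

lemma st_span (e : ℕ) (u : F) (hu : u ^ 2 ^ (e + 1) ≠ u) (d : Fin 4 → F)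
    (hd : InSuzukiTitsOvoid e d) (v : Fin 4 → F) :
    v ∈ Submodule.span F {d' | InSuzukiTitsOvoid e d' ∧ ∀ c : F, d' ≠ c • d} := by
  set S := Submodule.span F {d' | InSuzukiTitsOvoid e d' ∧ ∀ c : F, d' ≠ c • d} with hS
  have hu0 : u ≠ 0 := by
    rintro rfl; apply hu; simp
  have hu1 : u ≠ 1 := by
    rintro rfl; apply hu; simp
  have hu1' : u - 1 ≠ 0 := sub_ne_zero.2 hu1
  have hus : u ^ 2 ^ (e + 1) - u ≠ 0 := sub_ne_zero.2 hu
  have h0e : (0 : F) ^ 2 ^ (e + 1) = 0 := by simp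
  have hdS : d ∈ S := by
    obtain ⟨c, hc, h | ⟨x, y, h⟩⟩ := hd
    · have hd' : d = c⁻¹ • ![0, 0, 1, 0] := by
        rw [← h, smul_smul, inv_mul_cancel₀ hc, one_smul]
      have hm : ∀ x y, stv e x y ∈ S := by
        intro x y
        refine Submodule.subset_span ⟨st_Ov e x y, ?_⟩
        intro k hk
        have := congrFun hk 3
        rw [hd'] at this
        simp [stv] at this
      have e3 : (![0, 0, 1, 0] : Fin 4 → F) = (u ^ 2 ^ (e + 1) - u)⁻¹ •
          (stv e 0 u - u • stv e 0 1 + (u - 1) • stv e 0 0) := by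
        ext i
        fin_cases i <;> simp [stv]
        field_simp
      rw [hd']
      refine S.smul_mem _ ?_
      rw [e3]
      exact S.smul_mem _ (S.add_mem (S.sub_mem (hm _ _) (S.smul_mem _ (hm _ _)))
        (S.smul_mem _ (hm _ _)))
    · have hd' : d = c⁻¹ • stv e x y := by
        unfold stv
        rw [← h, smul_smul, inv_mul_cancel₀ hc, one_smul]
      have hm3 : (![0, 0, 1, 0] : Fin 4 → F) ∈ S := by
        refine Submodule.subset_span ⟨st_O3 e, ?_⟩
        intro k hk
        rw [hd'] at hk
        have h1 := congrFun hk 3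
        have h2 := congrFun hk 2
        simp [stv] at h1 h2
        rcases h1 with h1 | h1
        · simp [h1] at h2
        · exact hc h1
      have hm : ∀ y', y' ≠ y → stv e x y' ∈ S := by
        intro y' hy
        refine Submodule.subset_span ⟨st_Ov e x y', ?_⟩
        intro k hk
        rw [hd', smul_smul] at hk
        have h1 := congrFun hk 3
        have h2 := congrFun hk 1
        simp [stv] at h1 h2
        rw [← h1, one_mul] at h2
        exact hy h2
      rw [hd']
      refine S.smul_mem _ ?_
      have m1 := hm (y + 1) (by simp)
      have m2 := hm (y + u) (by simpa using hu0)
      set w := stv e x (y + 1) + (u - 1)⁻¹ • (stv e x (y + 1) - stv e x (y + u)) with hw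
      have hwS : w ∈ S := S.add_mem m1 (S.smul_mem _ (S.sub_mem m1 m2))
      have : stv e x y = w + (stv e x y 2 - w 2) • ![0, 0, 1, 0] := by
        have w0 : w 0 = x := by simp [hw, stv]
        have w1 : w 1 = y := by simp [hw, stv]; field_simp; ring
        have w3 : w 3 = 1 := by simp [hw, stv]
        ext i
        fin_cases i
        · simp [w0]; simp [stv]
        · simp [w1]; simp [stv]
        · simp
        · simp [w3]; simp [stv]
      rw [this]
      exact S.add_mem hwS (S.smul_mem _ hm3)
  have hall : ∀ d', InSuzukiTitsOvoid e d' → d' ∈ S := by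
    intro d' hd'
    by_cases h : ∃ c : F, d' = c • d
    · obtain ⟨c, rfl⟩ := h
      exact S.smul_mem _ hdS
    · push Not at h
      exact Submodule.subset_span ⟨hd', h⟩
  have m3 := hall _ (st_O3 e)
  have m4 := hall _ (st_Ov e 0 0)
  have m1 := hall _ (st_Ov e 1 0)
  have m2 := hall _ (st_Ov e 0 1)
  have : v = v 0 • stv e 1 0 + v 1 • stv e 0 1 + (v 3 - v 0 - v 1) • stv e 0 0
      + (v 2 - v 0 - v 1) • ![0, 0, 1, 0] := by
    ext i
    fin_cases i <;> simp [stv]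
  rw [this]
  exact S.add_mem (S.add_mem (S.add_mem (S.smul_mem _ m1) (S.smul_mem _ m2)) (S.smul_mem _ m4))
    (S.smul_mem _ m3)

lemma st_scalar (e : ℕ) (u : F) (hu : u ^ 2 ^ (e + 1) ≠ u) (θ : (Fin 4 → F) → (Fin 4 → F))
    (hadd : ∀ x y, θ (x + y) = θ x + θ y)
    (hθ : ∀ d, InSuzukiTitsOvoid e d → ∃ c : F, θ d = c • d) :
    ∃ m : F, ∀ v, θ v = m • v := by
  have hu0 : u ≠ 0 := by
    rintro rfl; apply hu; simp
  have hu1 : u ≠ 1 := by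
    rintro rfl; apply hu; simp
  have hz : θ 0 = 0 := by
    have := hadd 0 0
    simpa using this
  have hθ' : ∀ d, InSuzukiTitsOvoid e d → ∀ t : F, ∃ c : F, θ (t • d) = c • d := by
    intro d hd t
    by_cases ht : t = 0
    · exact ⟨0, by simp [ht, hz]⟩
    obtain ⟨c, hc⟩ := hθ _ (st_Os e d t ht hd)
    exact ⟨c * t, by rw [hc, smul_smul]⟩
  choose h hh using hθ' _ (st_O3 (F := F) e)
  choose m hm using fun x y : F => hθ' _ (st_Ov e x y)
  set g := m 0 0 with hgdef
  have hadd3 : ∀ s t, h (s + t) = h s + h t := by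
    intro s t
    have h1 := hh (s + t)
    rw [add_smul, hadd, hh, hh] at h1
    have := congrFun h1 2
    simpa using this.symm
  have hadd4 : ∀ s t, g (s + t) = g s + g t := by
    intro s t
    have h1 := hm 0 0 (s + t)
    rw [add_smul, hadd, hm, hm] at h1
    have := congrFun h1 3
    simpa [stv] using this.symm
  have E3 : ∀ t : F, θ ![0, 0, t, 0] = ![0, 0, h t, 0] := by
    intro t
    have := hh t
    simpa using this
  have E4 : ∀ t : F, θ ![0, 0, 0, t] = ![0, 0, 0, g t] := by
    intro t
    have := hm 0 0 t
    simpa [stv] using this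
  -- second coordinate
  have K2 : ∀ t y : F, θ ![0, t * y, 0, 0] =
      ![0, m 0 y t * y, m 0 y t * y ^ 2 ^ (e + 1) - h (t * y ^ 2 ^ (e + 1)), m 0 y t - g t] := by
    intro t y
    have h1 := hm 0 y t
    have : t • stv e 0 y = ![0, t * y, 0, 0] + ![0, 0, t * y ^ 2 ^ (e + 1), 0] + ![0, 0, 0, t] := by
      ext i; fin_cases i <;> simp [stv]
    rw [this, hadd, hadd, E3, E4] at h1
    have h2 := eq_sub_of_add_eq (eq_sub_of_add_eq h1)
    rw [h2]
    ext i; fin_cases i <;> simp [stv]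
  set A : F → F := fun s => θ ![0, s, 0, 0] 1 with hA
  set B : F → F := fun s => θ ![0, s, 0, 0] 2 with hB
  set C : F → F := fun s => θ ![0, s, 0, 0] 3 with hC
  have K2' : ∀ s w : F, w ≠ 0 → m 0 w⁻¹ (s * w) = A s * w ∧ C s = A s * w - g (s * w) ∧
      B s = A s * w * (w⁻¹) ^ 2 ^ (e + 1) - h (s * w * (w⁻¹) ^ 2 ^ (e + 1)) := by
    intro s w hw
    have h1 := K2 (s * w) w⁻¹
    have h2 : s * w * w⁻¹ = s := by field_simp
    rw [h2] at h1
    have hA1 : A s = m 0 w⁻¹ (s * w) * w⁻¹ := by rw [hA]; simp [h1]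
    have hB1 : B s = _ := congrFun h1 2
    have hC1 : C s = _ := congrFun h1 3
    have hA2 : m 0 w⁻¹ (s * w) = A s * w := by rw [hA1]; field_simp
    simp [hA2] at hB1 hC1
    refine ⟨hA2, hC1, ?_⟩
    rw [hB1]
    simp
  have hC0 : ∀ s, C s = 0 := by
    intro s
    have h1 := (K2' s 1 one_ne_zero).2.1
    have h2 := (K2' s (u - 1) (sub_ne_zero.2 hu1)).2.1
    have h3 := (K2' s u hu0).2.1
    have h4 := hadd4 (s * 1) (s * (u - 1))
    have h5 : s * 1 + s * (u - 1) = s * u := by ring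
    rw [h5] at h4
    linear_combination h1 + h2 - h3 + h4
  have hg : ∀ w, g w = A 1 * w := by
    intro w
    by_cases hw : w = 0
    · have := hadd4 0 0
      simp at this
      simp [hw, this]
    · have h1 := (K2' 1 w hw).2.1
      rw [hC0, one_mul] at h1
      linear_combination h1
  have hAs : ∀ s, A s = A 1 * s := by
    intro s
    have h1 := (K2' s 1 one_ne_zero).2.1
    rw [hC0, hg] at h1
    linear_combination -h1
  have hB1 : ∀ s, B s = A 1 * s - h s := by
    intro s
    have h1 := (K2' s 1 one_ne_zero).2.2
    rw [h1, hAs s]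
    simp
  have hh1 : ∀ s, h s = A 1 * s := by
    intro s
    set k := u⁻¹ * u ^ 2 ^ (e + 1) with hk
    have hk1 : k - 1 ≠ 0 := by
      intro hk'
      apply hu
      have : u * (k - 1) = 0 := by rw [hk']; simp
      rw [hk] at this
      field_simp at this
      linear_combination this
    have key : ∀ r, h (r * k) = A 1 * (r * k) - B r := by
      intro r
      have h1 := (K2' r u⁻¹ (inv_ne_zero hu0)).2.2
      rw [inv_inv, hAs r, mul_assoc r, ← hk] at h1
      rw [h1, hk]
      ring
    have h2 := key (s / (k - 1))
    rw [hB1] at h2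
    have h3 := hadd3 s (s / (k - 1))
    have h4 : s + s / (k - 1) = s / (k - 1) * k := by field_simp; ring
    rw [h4] at h3
    have h5 : s / (k - 1) * k - s / (k - 1) = s := by rw [← h4]; ring
    linear_combination h2 - h3 + A 1 * h5
  have hB0 : ∀ s, B s = 0 := by
    intro s; rw [hB1, hh1, sub_self]
  have E2 : ∀ s : F, θ ![0, s, 0, 0] = ![0, A 1 * s, 0, 0] := by
    intro s
    ext i
    fin_cases i
    · have := K2 s 1
      rw [mul_one] at this
      simp [this]
    · exact hAs s
    · exact hB0 s
    · exact hC0 s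
  have K1 : ∀ t x : F, θ ![t * x, 0, 0, 0] =
      ![m x 0 t * x, 0, (m x 0 t - A 1 * t) * (x ^ 2 * x ^ 2 ^ (e + 1)), m x 0 t - A 1 * t] := by
    intro t x
    have h1 := hm x 0 t
    have : t • stv e x 0 = ![t * x, 0, 0, 0] + ![0, 0, t * (x ^ 2 * x ^ 2 ^ (e + 1)), 0]
        + ![0, 0, 0, t] := by
      ext i; fin_cases i <;> simp [stv]
    rw [this, hadd, hadd, E3, E4, hg, hh1] at h1
    have h2 := eq_sub_of_add_eq (eq_sub_of_add_eq h1)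
    rw [h2]
    ext i; fin_cases i <;> simp [stv]
    ring
  have E1 : ∀ s : F, θ ![s, 0, 0, 0] = ![A 1 * s, 0, 0, 0] := by
    intro s
    have h1 := K1 s 1
    have h2 := K1 (s / u) u
    rw [mul_one] at h1
    rw [div_mul_cancel₀ s hu0] at h2
    have a0 := (congrFun h1 0).symm.trans (congrFun h2 0)
    have a3 := (congrFun h1 3).symm.trans (congrFun h2 3)
    simp at a0 a3
    have a4 : A 1 * (s / u) * u = A 1 * s := by field_simp
    have a5 : m 1 0 s = A 1 * s := by
      have h6 : (1 - u) * (m 1 0 s - A 1 * s) = 0 := by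
        linear_combination (-u) * a3 + a0 + a4
      rcases mul_eq_zero.1 h6 with h7 | h7
      · exact absurd (sub_eq_zero.1 h7).symm hu1
      · exact sub_eq_zero.1 h7
    rw [h1, a5]
    ext i; fin_cases i <;> simp
  refine ⟨A 1, fun v => ?_⟩
  have hv : v = ![v 0, 0, 0, 0] + ![0, v 1, 0, 0] + ![0, 0, v 2, 0] + ![0, 0, 0, v 3] := by
    ext i; fin_cases i <;> simp
  have hv2 : A 1 • v = ![A 1 * v 0, 0, 0, 0] + ![0, A 1 * v 1, 0, 0] + ![0, 0, A 1 * v 2, 0]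
      + ![0, 0, 0, A 1 * v 3] := by
    ext i; fin_cases i <;> simp
  rw [hv2]
  conv_lhs => rw [hv]
  rw [hadd, hadd, hadd, E1, E2, E3, E4, hg, hh1]

open Polynomial in
lemma st_poly [Fintype F] (e : ℕ) (he : 1 ≤ e) (hcard : Fintype.card F = 2 ^ (2 * e + 1))
    (b c d f : F) (h : ∀ Y : F, b * Y ^ 2 + c * Y ^ (2 ^ (e + 1) + 1) + d * Y ^ 2 ^ (e + 1)
      + f * Y = 0) : d = 0 := by
  have hs : 4 ≤ 2 ^ (e + 1) := by
    calc 4 = 2 ^ 2 := by norm_num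
      _ ≤ 2 ^ (e + 1) := Nat.pow_le_pow_right (by norm_num) (by omega)
  have hq : 2 ^ (e + 1) + 1 < Fintype.card F := by
    rw [hcard]
    have : 2 ^ (e + 2) ≤ 2 ^ (2 * e + 1) := Nat.pow_le_pow_right (by norm_num) (by omega)
    rw [pow_succ] at this
    omega
  set s := 2 ^ (e + 1) with hsdef
  set p : F[X] := C b * X ^ 2 + C c * X ^ (s + 1) + C d * X ^ s + C f * X with hp
  have hdeg : p.natDegree ≤ s + 1 := by
    rw [hp]
    refine natDegree_add_le_of_degree_le (natDegree_add_le_of_degree_le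
      (natDegree_add_le_of_degree_le ?_ ?_) ?_) ?_
    · exact (natDegree_C_mul_X_pow_le _ _).trans (by omega)
    · exact (natDegree_C_mul_X_pow_le _ _)
    · exact (natDegree_C_mul_X_pow_le _ _).trans (by omega)
    · exact (natDegree_C_mul_le _ _).trans (natDegree_X_le.trans (by omega))
  have hp0 : p = 0 := by
    refine Polynomial.eq_zero_of_natDegree_lt_card_of_eval_eq_zero p Function.injective_id
      (fun Y => ?_) (by omega)
    rw [hp]
    simpa using h Y
  have hc : p.coeff s = d := by
    rw [hp]
    simp [coeff_X_pow, coeff_X]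
    have h1 : s ≠ 2 := by omega
    have h2 : s ≠ 1 := by omega
    simp [h1, Ne.symm h2]
  rw [← hc, hp0, coeff_zero]

lemma st_u [Fintype F] (e : ℕ) (he : 1 ≤ e) (hcard : Fintype.card F = 2 ^ (2 * e + 1)) :
    ∃ u : F, u ^ 2 ^ (e + 1) ≠ u := by
  by_contra hcon
  push Not at hcon
  have := st_poly e he hcard 0 0 1 (-1) (fun Y => by rw [hcon]; ring)
  exact one_ne_zero this

end Helpers

/-- For `q = 2^(2e+1)`, `e ≥ 1`, the affine polar graph
`VO₄⁻(q)` (defined by a non-degenerate quadratic form `κ` of minus type on `F⁴`)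
and the Suzuki–Tits ovoid graph `VSz(q)` are not isomorphic. -/
theorem affine_polar_minus_not_iso_suzuki_tits {F : Type*} [Field F] [Fintype F]
    (e : ℕ) (he : 1 ≤ e) (hcard : Fintype.card F = 2 ^ (2 * e + 1))
    (κ : QuadraticForm F (Fin 4 → F))
    (hnd : ∀ x : Fin 4 → F, (∀ y, QuadraticMap.polar (⇑κ) x y = 0) → x = 0)
    (hminus : ∀ W : Submodule F (Fin 4 → F), Module.finrank F ↥W = 2 →
      ∃ w ∈ W, κ w ≠ 0) :
    ¬ ∃ φ : (Fin 4 → F) ≃ (Fin 4 → F),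
      ∀ u v : Fin 4 → F,
        (φ u ≠ φ v ∧ InSuzukiTitsOvoid e (φ u - φ v)) ↔ (u ≠ v ∧ κ (u - v) = 0) := by
  rintro ⟨φ, hφ⟩
  obtain ⟨u, hu⟩ := st_u (F := F) e he hcard
  have hψ : ∀ x y, InSuzukiTitsOvoid e (x - y) ↔
      (φ.symm x ≠ φ.symm y ∧ κ (φ.symm x - φ.symm y) = 0) := by
    intro x y
    rw [← hφ]
    simp only [Equiv.apply_symm_apply]
    exact ⟨fun h => ⟨sub_ne_zero.1 (st_O0 e _ h), h⟩, fun h => h.2⟩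
  have hadd := st_add κ hminus _ (st_O0 e) (st_Os e) (st_span e u hu) φ.symm hψ _ (st_O3 e)
  have hline := st_line κ hminus _ (st_O0 e) (st_Os e) φ.symm hψ 0
  set Ψ : (Fin 4 → F) ≃ (Fin 4 → F) := φ.symm.trans (Equiv.subRight (φ.symm 0)) with hΨ
  have hΨa : ∀ x, Ψ x = φ.symm x - φ.symm 0 := fun x => rfl
  have hΨadd : ∀ x y, Ψ (x + y) = Ψ x + Ψ y := hadd
  have hΨs : ∀ x y, Ψ.symm (x + y) = Ψ.symm x + Ψ.symm y := by
    intro x y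
    apply Ψ.injective
    rw [hΨadd]; simp
  have hiso : ∀ d, InSuzukiTitsOvoid e d → κ (Ψ d) = 0 := by
    intro d hd
    exact ((hψ d 0).1 (by simpa using hd)).2
  have hlin : ∀ d, InSuzukiTitsOvoid e d → ∀ l : F, ∃ c : F, Ψ (c • d) = l • Ψ d := by
    intro d hd l
    obtain ⟨f, hf, hfx⟩ := hline d hd
    obtain ⟨c, rfl⟩ := hf l
    refine ⟨c, ?_⟩
    have := hfx c
    rw [zero_add, zero_add] at this
    rw [hΨa, hΨa, this]
    abel
  have hτ : ∀ l : F, ∃ m : F, ∀ v, Ψ.symm (l • Ψ v) = m • v := by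
    intro l
    refine st_scalar e u hu (fun v => Ψ.symm (l • Ψ v)) ?_ ?_
    · intro x y
      rw [hΨadd, smul_add, hΨs]
    · intro d hd
      obtain ⟨c, hc⟩ := hlin d hd l
      exact ⟨c, by rw [← hc, Equiv.symm_apply_apply]⟩
  choose τ hτ using hτ
  have hτ' : ∀ l v, Ψ (τ l • v) = l • Ψ v := by
    intro l v
    rw [← hτ, Equiv.apply_symm_apply]
  have hΨ0 : Ψ 0 = 0 := by rw [hΨa, sub_self]
  have hne : Ψ (stv e 0 0) ≠ 0 := by
    intro h
    exact st_O0 e _ (st_Ov e 0 0) (Ψ.injective (h.trans hΨ0.symm))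
  have hpow : ∀ (l : F) (n : ℕ), τ (l ^ n) = τ l ^ n := by
    have hw0 := st_O0 e _ (st_Ov (F := F) e 0 0)
    have hmul : ∀ l k, τ (l * k) = τ l * τ k := by
      intro l k
      apply smul_left_injective F hw0
      apply Ψ.injective
      simp only
      rw [hτ', mul_smul, mul_smul, hτ', hτ']
    have hone : τ 1 = 1 := by
      apply smul_left_injective F hw0
      apply Ψ.injective
      simp only
      rw [hτ', one_smul, one_smul]
    intro l n
    induction n with
    | zero => simp [hone]
    | succ n ih => rw [pow_succ, hmul, ih, pow_succ]
  set a2 := Ψ ![0, 1, 0, 0] with ha2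
  set a3 := Ψ ![0, 0, 1, 0] with ha3
  set a4 := Ψ (stv e 0 0) with ha4
  have hk3 : κ a3 = 0 := hiso _ (st_O3 e)
  have hk4 : κ a4 = 0 := hiso _ (st_Ov e 0 0)
  have hz : ∀ Y : F, κ (Y • a2 + Y ^ 2 ^ (e + 1) • a3 + a4) = 0 := by
    intro Y
    have h1 := hiso _ (st_Ov e 0 (τ Y))
    have h2 : stv e 0 (τ Y) = τ Y • ![0, 1, 0, 0] + τ (Y ^ 2 ^ (e + 1)) • ![0, 0, 1, 0]
        + stv e 0 0 := by
      rw [hpow]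
      ext i; fin_cases i <;> simp [stv]
    rw [h2, hΨadd, hΨadd, hτ', hτ'] at h1
    exact h1
  have hB := st_poly e he hcard (κ a2) (QuadraticMap.polar (⇑κ) a2 a3)
    (QuadraticMap.polar (⇑κ) a4 a3) (QuadraticMap.polar (⇑κ) a2 a4) (by
      intro Y
      have h1 := hz Y
      rw [QuadraticMap.map_add (⇑κ), QuadraticMap.map_add (⇑κ), QuadraticMap.polar_add_left,
        QuadraticMap.map_smul, QuadraticMap.map_smul, QuadraticMap.polar_smul_left,
        QuadraticMap.polar_smul_left, QuadraticMap.polar_smul_left,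
        QuadraticMap.polar_smul_right, hk3, hk4, QuadraticMap.polar_comm (⇑κ) a3 a4] at h1
      simp only [smul_eq_mul] at h1
      rw [pow_succ]
      linear_combination h1)
  obtain ⟨c, hc⟩ := st_isodep κ hminus a4 a3 hk4 hk3 hB hne
  rw [← hτ'] at hc
  have h1 := congrFun (Ψ.injective hc) 3
  have h2 := congrFun (Ψ.injective hc) 2
  simp [stv] at h1 h2
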